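/- arXiv:0908.1956 — 3 statements merged into one kernel-verified Lean document; each statement's English description precedes it below -/
import Mathlib

section
/- Alternating product formula: Let d ≥ 1 and let X be a d-dimensional combinatorial cell structure such that H_i(X) = 0 (as an abelian group, over ℤ) for all −1 ≤ i ≤ d−1. Then for every 1 ≤ k ≤ d: τ_k(X) · ∏_{0 ≤ i ≤ k, k−i odd} π_i(X) = ∏_{0 ≤ i ≤ k, k−i even} π_i(X), an equality of positive real numbers (equivalently, τ_k(X) = ∏_{i=0}^k π_i(X)^{(−1)^{k−i}}). -/
open BigOperators Matrix

/-- A `d`-dimensional combinatorial cell structure: nonempty finite sets of `i`-cells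
(of sizes `c i`, with `c i = 0` for `i > d`) together with integer boundary matrices
`D i` (the matrix of `∂_{i+1}`), satisfying `∂ ∘ ∂ = 0` and the condition that every
column of `∂_1 = D 0` sums to zero. -/
structure CellStructure (d : ℕ) where
  c : ℕ → ℕ
  c_pos : ∀ i, i ≤ d → 0 < c i
  c_zero : ∀ i, d < i → c i = 0
  D : (i : ℕ) → Matrix (Fin (c i)) (Fin (c (i + 1))) ℤ
  dd : ∀ i, D i * D (i + 1) = 0
  colsum : ∀ j, ∑ i, D 0 i j = 0

namespace CellStructure

variable {d : ℕ} (X : CellStructure d)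

/-- The augmentation map `ε : ℤ^{X_0} → ℤ`. -/
def aug : (Fin (X.c 0) → ℤ) →ₗ[ℤ] ℤ where
  toFun v := ∑ i, v i
  map_add' u v := by simp [Finset.sum_add_distrib]
  map_smul' r v := by simp [Finset.mul_sum]

/-- The rational augmentation map. -/
def augQ : (Fin (X.c 0) → ℚ) →ₗ[ℚ] ℚ where
  toFun v := ∑ i, v i
  map_add' u v := by simp [Finset.sum_add_distrib]
  map_smul' r v := by simp [Finset.mul_sum]

/-- `bdry i` is the boundary map `∂_{i+1} : C_{i+1} → C_i`. -/
def bdry (i : ℕ) : (Fin (X.c (i + 1)) → ℤ) →ₗ[ℤ] (Fin (X.c i) → ℤ) :=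
  Matrix.toLin' (X.D i)

/-- Reduced cycles: `Zker i = ker ∂_i` (with `∂_0 = ε` the augmentation). -/
def Zker : (i : ℕ) → Submodule ℤ (Fin (X.c i) → ℤ)
  | 0 => LinearMap.ker X.aug
  | (i + 1) => LinearMap.ker (X.bdry i)

/-- Rational reduced cycles: kernel of `∂_i ⊗ ℚ`. -/
def ZkerQ : (i : ℕ) → Submodule ℚ (Fin (X.c i) → ℚ)
  | 0 => LinearMap.ker X.augQ
  | (i + 1) => LinearMap.ker (Matrix.toLin' ((X.D i).map (Int.cast : ℤ → ℚ)))

/-- Reduced homology `H_i(X) = ker ∂_i / im ∂_{i+1}` for `i ≥ 0`. -/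
abbrev H (i : ℕ) : Type :=
  X.Zker i ⧸ (LinearMap.range (X.bdry i)).comap (X.Zker i).subtype

/-- `Hred j` is the reduced homology in dimension `j - 1`; in particular
`Hred 0 = H_{-1}(X) = ℤ / im ε`. -/
def Hred : ℕ → Type
  | 0 => ℤ ⧸ LinearMap.range X.aug
  | (i + 1) => X.H i

/-- `β_i(X)`, the rank of the `i`-th reduced homology group. -/
noncomputable def beta (i : ℕ) : ℕ := Module.finrank ℤ (X.H i)

/-- `X` is acyclic in positive codimension. -/
def APC : Prop := ∀ i, i < d → X.beta i = 0

/-- The span of the columns of `∂_{j+1}` indexed by `T`. -/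
def colSpan (j : ℕ) (T : Finset (Fin (X.c (j + 1)))) : Submodule ℤ (Fin (X.c j) → ℤ) :=
  Submodule.span ℤ ((fun t => (X.D j)ᵀ t) '' (T : Set (Fin (X.c (j + 1)))))

/-- For `T ⊆ X_{j+1}`, the homology group `H_j(X_T)` of the subcomplex `X_T`. -/
abbrev Hsub (j : ℕ) (T : Finset (Fin (X.c (j + 1)))) : Type :=
  X.Zker j ⧸ (X.colSpan j T).comap (X.Zker j).subtype

/-- `HsubG k T` is `H_{k-1}(X_T)` for `T ⊆ X_k`; for `k = 0` this is
`H_{-1}(X_T) = ℤ / (ℤ-span of the entries of ε on T)` (all of which equal `1`). -/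
def HsubG : (k : ℕ) → Finset (Fin (X.c k)) → Type
  | 0, T => ℤ ⧸ Submodule.span ℤ ((fun _v => (1 : ℤ)) '' (T : Set (Fin (X.c 0))))
  | (j + 1), T => X.Hsub j T

/-- `T ⊆ X_{j+1}` is a cellular spanning `(j+1)`-tree of `X`. -/
def IsTree (j : ℕ) (T : Finset (Fin (X.c (j + 1)))) : Prop :=
  LinearIndependent ℤ (fun t : {f // f ∈ T} => (X.D j)ᵀ (t : Fin (X.c (j + 1))))
    ∧ Nat.card (X.Hsub j T) ≠ 0
    ∧ T.card = Module.finrank ℚ (X.ZkerQ j)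

/-- `IsTreeG k T` : `T ⊆ X_k` is a cellular spanning `k`-tree of `X`; a spanning
`0`-tree is a single vertex. -/
def IsTreeG : (k : ℕ) → Finset (Fin (X.c k)) → Prop
  | 0, T => LinearIndependent ℤ (fun _t : {f // f ∈ T} => (1 : ℤ))
      ∧ Nat.card (ℤ ⧸ Submodule.span ℤ ((fun _v => (1 : ℤ)) '' (T : Set (Fin (X.c 0))))) ≠ 0
      ∧ T.card = 1
  | (j + 1), T => X.IsTree j T

open Classical in
/-- The torsion-weighted spanning tree enumerators `τ_k(X)`, with `τ_0(X) = |X_0|`. -/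
noncomputable def tau : ℕ → ℕ
  | 0 => X.c 0
  | (j + 1) => ∑ T : Finset (Fin (X.c (j + 1))),
      if X.IsTree j T then (Nat.card (X.Hsub j T)) ^ 2 else 0

/-- The real boundary matrix of `∂_{i+1}`. -/
noncomputable def Dr (i : ℕ) : Matrix (Fin (X.c i)) (Fin (X.c (i + 1))) ℝ :=
  (X.D i).map (Int.cast : ℤ → ℝ)

/-- The up-down Laplacian `L^ud_i = ∂_{i+1} ∂_{i+1}^T` as a real matrix. -/
noncomputable def Lud (i : ℕ) : Matrix (Fin (X.c i)) (Fin (X.c i)) ℝ :=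
  X.Dr i * (X.Dr i)ᴴ

theorem Lud_isHermitian (i : ℕ) : (X.Lud i).IsHermitian :=
  Matrix.isHermitian_mul_conjTranspose_self _

/-- `π_k(X)`: the product of the nonzero eigenvalues of `L^ud_{k-1}` for `k ≥ 1`,
and `π_0(X) = |X_0|`. -/
noncomputable def piNZ : ℕ → ℝ
  | 0 => (X.c 0 : ℝ)
  | (j + 1) => ∏ i, (if (X.Lud_isHermitian j).eigenvalues i = 0 then 1
      else (X.Lud_isHermitian j).eigenvalues i)

end CellStructure

namespace Matrix

theorem det_mul_eq_sum_functions {m R : Type*} [Fintype m] [CommRing R] {r : ℕ}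
    (A : Matrix (Fin r) m R) (B : Matrix m (Fin r) R) :
    (A * B).det = ∑ f : Fin r → m, (∏ i, A i (f i)) * (B.submatrix f id).det := by
  classical
  have h : A * B = fun i => ∑ j, A i j • B j := by
    ext i k
    simp [Matrix.mul_apply, Finset.sum_apply]
  have h2 := (detRowAlternating (n := Fin r) (R := R)).toMultilinearMap.map_sum
    (fun i j => A i j • B j)
  rw [h]
  refine h2.trans (Finset.sum_congr rfl fun f _ => ?_)
  exact (detRowAlternating (n := Fin r) (R := R)).toMultilinearMap.map_smul_univ
    (fun i => A i (f i)) (fun i => B (f i))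

/-- The **Cauchy–Binet formula**. -/
theorem det_mul_eq_sum_det_mul_det {m R : Type*} [Fintype m] [LinearOrder m] [CommRing R] {r : ℕ}
    (A : Matrix (Fin r) m R) (B : Matrix m (Fin r) R) :
    (A * B).det = ∑ T : Finset m, if h : T.card = r then
      (A.submatrix id (T.orderEmbOfFin h)).det * (B.submatrix (T.orderEmbOfFin h) id).det
      else 0 := by
  rw [det_mul_eq_sum_functions,
    ← Finset.sum_fiberwise Finset.univ (fun f : Fin r → m => Finset.univ.image f)]
  refine Finset.sum_congr rfl fun T _ => ?_
  split_ifs with h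
  · set e := T.orderEmbOfFin h
    have key : ∑ f : Fin r → m with Finset.univ.image f = T,
        (∏ i, A i (f i)) * (B.submatrix f id).det =
        ∑ σ : Equiv.Perm (Fin r), (∏ i, A i (e (σ i))) * (B.submatrix (e ∘ σ) id).det := by
      symm
      refine Finset.sum_bij (fun σ _ => e ∘ σ) ?_ ?_ ?_ ?_
      · intro σ _
        rw [Finset.mem_filter]
        refine ⟨Finset.mem_univ _, ?_⟩
        apply Finset.coe_injective
        rw [Finset.coe_image, Finset.coe_univ, Set.image_univ, Set.range_comp,
          σ.surjective.range_eq, Set.image_univ, Finset.range_orderEmbOfFin]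
      · intro σ _ τ _ hst
        ext i
        exact congrArg Fin.val (e.injective (congrFun hst i))
      · intro f hf
        have hf' : Finset.univ.image f = T := (Finset.mem_filter.mp hf).2
        have hinj : Function.Injective f := by
          rw [← Set.injOn_univ, ← Finset.coe_univ]
          exact Finset.card_image_iff.mp (by rw [hf', h, Finset.card_univ, Fintype.card_fin])
        have hex : ∀ i, ∃ k, e k = f i := fun i => by
          have : f i ∈ Set.range e := by
            rw [Finset.range_orderEmbOfFin, ← hf']
            simp
          exact this
        choose g hg using hex
        have hgi : Function.Injective g := fun a b hab => hinj (by rw [← hg, ← hg, hab])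
        exact ⟨Equiv.ofBijective g (Finite.injective_iff_bijective.mp hgi), Finset.mem_univ _,
          funext hg⟩
      · intro σ _
        rfl
    rw [key, ← det_transpose (A.submatrix id e), det_apply', Finset.sum_mul]
    refine Finset.sum_congr rfl fun σ _ => ?_
    have : B.submatrix (e ∘ σ) id = (B.submatrix e id).submatrix σ id := rfl
    rw [this, det_permute]
    simp only [transpose_apply, submatrix_apply, id]
    ring
  · refine Finset.sum_eq_zero fun f hf => ?_
    have hf' : Finset.univ.image f = T := (Finset.mem_filter.mp hf).2
    have hinj : ¬ Function.Injective f := fun hi => h (by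
      rw [← hf', Finset.card_image_of_injective _ hi, Finset.card_univ, Fintype.card_fin])
    rw [Function.not_injective_iff] at hinj
    obtain ⟨a, b, hab, hne⟩ := hinj
    rw [det_zero_of_row_eq hne (by ext k; simp [hab]), mul_zero]

theorem natCard_quotient_range_mulVecLin {r : Type*} [Fintype r] [DecidableEq r]
    (M : Matrix r r ℤ) :
    Nat.card ((r → ℤ) ⧸ LinearMap.range M.mulVecLin) = M.det.natAbs := by
  by_cases h : M.det = 0
  · rw [h, Int.natAbs_zero]
    obtain ⟨w, hw, hwM⟩ := exists_vecMul_eq_zero_iff.mpr h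
    obtain ⟨i, hi⟩ := Function.ne_iff.mp hw
    have : Infinite ((r → ℤ) ⧸ LinearMap.range M.mulVecLin) := by
      refine Infinite.of_injective
        (fun n : ℤ => Submodule.Quotient.mk (Pi.single i n : r → ℤ)) fun a b hab => ?_
      obtain ⟨v, hv⟩ := (Submodule.Quotient.eq _).mp hab
      have h0 : w ⬝ᵥ (M *ᵥ v) = 0 := by rw [dotProduct_mulVec, hwM, zero_dotProduct]
      rw [mulVecLin_apply] at hv
      rw [hv, dotProduct_sub, dotProduct_single, dotProduct_single, ← mul_sub] at h0
      exact sub_eq_zero.mp ((mul_eq_zero.mp h0).resolve_left hi)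
    exact Nat.card_eq_zero_of_infinite
  · have hinj : Function.Injective M.mulVecLin := by
      rw [coe_mulVecLin, mulVec_injective_iff]
      exact linearIndependent_cols_of_det_ne_zero h
    rw [← Submodule.natAbs_det_equiv _ (LinearEquiv.ofInjective M.mulVecLin hinj),
      ← LinearMap.det_toLin' M]
    rfl

theorem prod_nonzero_eigenvalues_eq_abs_det {n r : Type*} [Fintype n] [DecidableEq n] [Fintype r]
    [DecidableEq r] (P : Matrix n r ℝ) (Q : Matrix r n ℝ) (L : Matrix n n ℝ)
    (hL : L.IsHermitian) (hPSD : L.PosSemidef) (hPQ : L = P * Q) (hdet : (Q * P).det ≠ 0) :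
    ∏ i, (if hL.eigenvalues i = 0 then 1 else hL.eigenvalues i) = |(Q * P).det| := by
  have h0 : (Q * P).charpoly.coeff 0 ≠ 0 := fun h => hdet (by
    rw [det_eq_sign_charpoly_coeff, h, mul_zero])
  have h := congrArg (fun p => |Polynomial.trailingCoeff p|) (charpoly_mul_comm' P Q)
  have htX : ∀ k : ℕ, ((Polynomial.X : Polynomial ℝ) ^ k).trailingCoeff = 1 := fun k => by
    rw [Polynomial.X_pow_eq_monomial, Polynomial.trailingCoeff]
    rw [Polynomial.natTrailingDegree_monomial one_ne_zero, Polynomial.coeff_monomial, if_pos rfl]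
  have htp : ∀ f : n → Polynomial ℝ,
      (∏ i, f i).trailingCoeff = ∏ i, (f i).trailingCoeff := fun f => by
    induction (Finset.univ : Finset n) using Finset.induction_on with
    | empty => simpa using htX 0
    | insert a s ha ih =>
      rw [Finset.prod_insert ha, Finset.prod_insert ha, Polynomial.trailingCoeff_mul, ih]
  simp only [Polynomial.trailingCoeff_mul, htX, one_mul] at h
  rw [Polynomial.trailingCoeff_eq_coeff_zero h0, ← hPQ, hL.charpoly_eq, htp,
    Finset.abs_prod] at h
  rw [det_eq_sign_charpoly_coeff, abs_mul, abs_pow, abs_neg, abs_one, one_pow, one_mul, ← h]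
  refine Finset.prod_congr rfl fun i _ => ?_
  split_ifs with hi
  · have := htX 1
    simp only [pow_one] at this
    simp [hi, this]
  · rw [Polynomial.trailingCoeff_eq_coeff_zero (by simpa using hi)]
    have := hPSD.eigenvalues_nonneg i
    simp [abs_of_nonneg this]

theorem det_transpose_mul_self_ne_zero {n r : Type*} [Fintype n] [Fintype r] [DecidableEq r]
    (B : Matrix n r ℤ) (hB : Function.Injective B.mulVec) : (Bᵀ * B).det ≠ 0 := by
  intro h
  obtain ⟨v, hv, hv0⟩ := exists_mulVec_eq_zero_iff.mpr h
  refine hv (hB ?_)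
  rw [mulVec_zero]
  refine dotProduct_self_eq_zero.mp ?_
  rw [dotProduct_mulVec, vecMul_mulVec, ← dotProduct_mulVec, hv0, dotProduct_zero]

theorem map_intCast_mul {l m n : Type*} [Fintype m] (R : Type*) [Ring R] (A : Matrix l m ℤ)
    (B : Matrix m n ℤ) :
    (A * B).map (Int.cast : ℤ → R) = A.map (Int.cast : ℤ → R) * B.map (Int.cast : ℤ → R) :=
  Matrix.map_mul (f := Int.castRingHom R)

theorem map_intCast_mul_eq_one {m n : Type*} [Fintype m] [DecidableEq n] (R : Type*) [Ring R]
    {A : Matrix n m ℤ} {B : Matrix m n ℤ} (h : A * B = 1) :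
    A.map (Int.cast : ℤ → R) * B.map (Int.cast : ℤ → R) = 1 := by
  rw [← map_intCast_mul, h, Matrix.map_one _ Int.cast_zero Int.cast_one]

/-- A short exact sequence of finite free abelian groups, with matrices `B` and `A`, has
`det (Bᵀ * B) = det (A * Aᵀ)`. -/
theorem gram_eq_of_exact {n r s : Type*} [Fintype n] [DecidableEq n] [Fintype r] [DecidableEq r]
    [Fintype s] [DecidableEq s] (B : Matrix n r ℤ) (A : Matrix s n ℤ) (S : Matrix n s ℤ)
    (hAS : A * S = 1) (hAB : A * B = 0) (hB : Function.Injective B.mulVec)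
    (hex : ∀ v, A *ᵥ v = 0 → ∃ w, B *ᵥ w = v) :
    Fintype.card n = Fintype.card r + Fintype.card s ∧ (∃ C : Matrix r n ℤ, C * B = 1) ∧
      (Bᵀ * B).det ≠ 0 ∧ (Bᵀ * B).det = (A * Aᵀ).det := by
  have hB0 : ∀ v, B *ᵥ v = 0 → v = 0 := fun v hv => hB (by rw [hv, mulVec_zero])
  choose C' hC' using fun j : n => hex ((1 - S * A).col j) (by
    rw [← mulVec_single_one, mulVec_mulVec, Matrix.mul_sub, ← Matrix.mul_assoc, hAS, Matrix.mul_one,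
      Matrix.one_mul, sub_self, zero_mulVec])
  set C : Matrix r n ℤ := (Matrix.of C')ᵀ with hC
  have hBC : B * C = 1 - S * A := by
    ext i j
    exact congrFun (hC' j) i
  have hCB : C * B = 1 := by
    rw [← sub_eq_zero, ext_iff_mulVec]
    intro v
    rw [zero_mulVec]
    apply hB0
    rw [mulVec_mulVec, Matrix.mul_sub, ← Matrix.mul_assoc, hBC, Matrix.sub_mul, Matrix.mul_assoc S,
      hAB, Matrix.mul_zero, sub_zero, Matrix.one_mul, Matrix.mul_one, sub_self, zero_mulVec]
  have hCS : C * S = 0 := by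
    rw [ext_iff_mulVec]
    intro v
    rw [zero_mulVec]
    apply hB0
    rw [mulVec_mulVec, ← Matrix.mul_assoc, hBC, Matrix.sub_mul, Matrix.mul_assoc S,
      hAS, Matrix.one_mul, Matrix.mul_one, sub_self, zero_mulVec]
  have hM : fromCols B S * fromRows C A = 1 := by
    rw [fromCols_mul_fromRows, hBC, sub_add_cancel]
  have hM' : fromRows C A * fromCols B S = 1 := by
    rw [fromRows_mul_fromCols, hCB, hCS, hAB, hAS, fromBlocks_one]
  have hcard := square_of_invertible _ _ hM hM'
  have hdet := det_transpose_mul_self_ne_zero B hB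
  refine ⟨by rw [hcard, Fintype.card_sum], ⟨C, hCB⟩, hdet, ?_⟩
  let e : n ≃ r ⊕ s := Fintype.equivOfCardEq hcard
  set N := (fromCols B Aᵀ).submatrix id e with hN
  set M := (fromCols B S).submatrix id e with hM1
  have hNN : N.det * N.det = (Bᵀ * B).det * (A * Aᵀ).det := by
    have h1 : Nᵀ * N = (fromBlocks (Bᵀ * B) 0 0 (A * Aᵀ)).submatrix e e := by
      have h2 : Bᵀ * Aᵀ = 0 := by rw [← transpose_mul, hAB, transpose_zero]
      rw [hN, transpose_submatrix, transpose_fromCols, transpose_transpose,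
        ← submatrix_mul _ _ e id e Function.bijective_id, fromRows_mul_fromCols, h2, hAB]
    have h2 := congrArg det h1
    rwa [det_mul, det_transpose, det_submatrix_equiv_self, det_fromBlocks_zero₂₁] at h2
  have hNM : N.det * M.det = (Bᵀ * B).det := by
    have h1 : Nᵀ * M = (fromBlocks (Bᵀ * B) (Bᵀ * S) 0 1).submatrix e e := by
      rw [hN, hM1, transpose_submatrix, transpose_fromCols, transpose_transpose,
        ← submatrix_mul _ _ e id e Function.bijective_id, fromRows_mul_fromCols, hAB, hAS]
    have h2 := congrArg det h1
    rwa [det_mul, det_transpose, det_submatrix_equiv_self, det_fromBlocks_zero₂₁, det_one,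
      mul_one] at h2
  have hMu : M.det * M.det = 1 := by
    refine Int.isUnit_mul_self ?_
    refine isUnit_det_of_right_inverse (B := (fromRows C A).submatrix e id) ?_
    rw [hM1, submatrix_mul_equiv, hM, submatrix_id_id]
  refine mul_left_cancel₀ hdet ?_
  calc (Bᵀ * B).det * (Bᵀ * B).det = (N.det * N.det) * (M.det * M.det) := by rw [← hNM]; ring
    _ = (Bᵀ * B).det * (A * Aᵀ).det := by rw [hMu, mul_one, hNN]

end Matrix

namespace CellStructure

variable {d : ℕ} (X : CellStructure d)

theorem col_mem_Zker (j : ℕ) (t : Fin (X.c (j + 1))) : (X.D j)ᵀ t ∈ X.Zker j := by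
  cases j with
  | zero => exact LinearMap.mem_ker.mpr (X.colsum t)
  | succ j =>
    refine LinearMap.mem_ker.mpr (funext fun i => ?_)
    exact congrFun (congrFun (X.dd j) i) t

variable {X} {j r : ℕ} (b : Module.Basis (Fin r) ℤ (X.Zker j))

/-- The matrix of the inclusion of the cycles into the chains, for a basis of the cycles. -/
noncomputable def cycleMatrix : Matrix (Fin (X.c j)) (Fin r) ℤ := Matrix.of fun i l => (b l : _ → ℤ) i

/-- The matrix of the boundary map with values in the cycles, for a basis of the cycles. -/
noncomputable def coordMatrix : Matrix (Fin r) (Fin (X.c (j + 1))) ℤ :=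
  Matrix.of fun i t => b.equivFun ⟨(X.D j)ᵀ t, X.col_mem_Zker j t⟩ i

theorem cycleMatrix_mulVec (v : Fin r → ℤ) :
    cycleMatrix b *ᵥ v = (b.equivFun.symm v : Fin (X.c j) → ℤ) := by
  ext i
  simp [cycleMatrix, Matrix.mulVec, dotProduct, Module.Basis.equivFun_symm_apply, mul_comm]

theorem cycleMatrix_mulVec_injective : Function.Injective (cycleMatrix b).mulVec := by
  intro v w h
  rw [cycleMatrix_mulVec, cycleMatrix_mulVec] at h
  exact b.equivFun.symm.injective (Subtype.ext h)

theorem exists_cycleMatrix_mulVec_eq {v : Fin (X.c j) → ℤ} (hv : v ∈ X.Zker j) :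
    ∃ w, cycleMatrix b *ᵥ w = v :=
  ⟨b.equivFun ⟨v, hv⟩, by rw [cycleMatrix_mulVec, LinearEquiv.symm_apply_apply]⟩

theorem cycleMatrix_mul_coordMatrix : cycleMatrix b * coordMatrix b = X.D j := by
  ext i t
  have h := cycleMatrix_mulVec b (b.equivFun ⟨(X.D j)ᵀ t, X.col_mem_Zker j t⟩)
  rw [LinearEquiv.symm_apply_apply] at h
  exact congrFun h i

theorem natCard_Hsub_eq_natAbs_det (T : Finset (Fin (X.c (j + 1))))
    (f : Fin r → Fin (X.c (j + 1))) (hf : Set.range f = T) :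
    Nat.card (X.Hsub j T) = ((coordMatrix b).submatrix id f).det.natAbs := by
  rw [← Matrix.natCard_quotient_range_mulVecLin]
  refine Nat.card_congr (Submodule.Quotient.equiv _ _ b.equivFun ?_).toEquiv
  have hspan : X.colSpan j T = (LinearMap.range
      ((coordMatrix b).submatrix id f).mulVecLin).map (cycleMatrix b).mulVecLin := by
    rw [Matrix.range_mulVecLin, Submodule.map_span, ← Set.range_comp, colSpan, ← hf,
      ← Set.range_comp]
    congr 2
    ext l i
    have := congrFun (congrFun (cycleMatrix_mul_coordMatrix b) i) (f l)
    exact this.symm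
  have hB : (cycleMatrix b).mulVecLin = (X.Zker j).subtype ∘ₗ b.equivFun.symm.toLinearMap :=
    LinearMap.ext fun v => cycleMatrix_mulVec b v
  rw [hspan, hB, Submodule.map_comp, Submodule.comap_map_eq_of_injective
    (Submodule.injective_subtype _), ← Submodule.map_comp]
  simp

theorem isTree_of_det_ne_zero (hr : Module.finrank ℚ (X.ZkerQ j) = r)
    (T : Finset (Fin (X.c (j + 1)))) (hT : T.card = r)
    (hdet : ((coordMatrix b).submatrix id (T.orderEmbOfFin hT)).det ≠ 0) : X.IsTree j T := by
  refine ⟨?_, ?_, hT.trans hr.symm⟩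
  · have h1 := (Matrix.linearIndependent_cols_of_det_ne_zero hdet).map'
      (cycleMatrix b).mulVecLin (LinearMap.ker_eq_bot.mpr (cycleMatrix_mulVec_injective b))
    rw [← linearIndependent_equiv (T.orderIsoOfFin hT).toEquiv]
    have hcol : (fun t : {f // f ∈ T} => (X.D j)ᵀ (t : Fin (X.c (j + 1)))) ∘
        (T.orderIsoOfFin hT).toEquiv = (cycleMatrix b).mulVecLin ∘
          ((coordMatrix b).submatrix id (T.orderEmbOfFin hT)).col := by
      ext l i
      exact (congrFun (congrFun (cycleMatrix_mul_coordMatrix b) i) (T.orderEmbOfFin hT l)).symm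
    rw [hcol]
    exact h1
  · rw [natCard_Hsub_eq_natAbs_det b T _ (Finset.range_orderEmbOfFin T hT)]
    exact Int.natAbs_ne_zero.mpr hdet

theorem tau_succ_eq_det (hr : Module.finrank ℚ (X.ZkerQ j) = r) :
    (X.tau (j + 1) : ℤ) = (coordMatrix b * (coordMatrix b)ᵀ).det := by
  classical
  rw [Matrix.det_mul_eq_sum_det_mul_det, tau, Nat.cast_sum]
  refine Finset.sum_congr rfl fun T _ => ?_
  by_cases hT : T.card = r
  · have hcard := natCard_Hsub_eq_natAbs_det b T _ (Finset.range_orderEmbOfFin T hT)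
    have htr : ((coordMatrix b)ᵀ.submatrix (T.orderEmbOfFin hT) id).det =
        ((coordMatrix b).submatrix id (T.orderEmbOfFin hT)).det := by
      rw [← Matrix.transpose_submatrix, Matrix.det_transpose]
    rw [dif_pos hT, htr]
    split_ifs with h
    · rw [hcard, Nat.cast_pow, Int.natCast_natAbs, sq_abs, pow_two]
    · have h0 : ((coordMatrix b).submatrix id (T.orderEmbOfFin hT)).det = 0 :=
        not_not.mp fun hne => h (isTree_of_det_ne_zero b hr T hT hne)
      rw [h0, mul_zero, Nat.cast_zero]
  · rw [dif_neg hT, if_neg fun h => hT (h.2.2.trans hr), Nat.cast_zero]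

theorem coordMatrix_exists_right_inverse (h : Subsingleton (X.H j)) :
    ∃ S : Matrix (Fin (X.c (j + 1))) (Fin r) ℤ, coordMatrix b * S = 1 := by
  rw [← Matrix.mulVec_surjective_iff_exists_right_inverse]
  intro v
  have htop := Submodule.Quotient.subsingleton_iff.mp h
  have hmem : b.equivFun.symm v ∈
      (LinearMap.range (X.bdry j)).comap (X.Zker j).subtype := htop ▸ Submodule.mem_top
  obtain ⟨w, hw⟩ := hmem
  refine ⟨w, cycleMatrix_mulVec_injective b ?_⟩
  rw [Matrix.mulVec_mulVec, cycleMatrix_mul_coordMatrix, cycleMatrix_mulVec]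
  exact hw

theorem mem_Zker_succ_iff (v : Fin (X.c (j + 1)) → ℤ) :
    v ∈ X.Zker (j + 1) ↔ coordMatrix b *ᵥ v = 0 := by
  have h : v ∈ X.Zker (j + 1) ↔ X.D j *ᵥ v = 0 := Iff.rfl
  rw [h, ← cycleMatrix_mul_coordMatrix b, ← Matrix.mulVec_mulVec]
  exact (cycleMatrix_mulVec_injective b).eq_iff' (Matrix.mulVec_zero _)

variable (X) in
/-- A matrix with a right inverse whose kernel is the group of cycles `Zker j` and whose Gram
determinant is `τ_j`. -/
structure IsCyclePresentation (j : ℕ) {s : ℕ} (A : Matrix (Fin s) (Fin (X.c j)) ℤ) : Prop where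
  exists_right_inverse : ∃ S : Matrix (Fin (X.c j)) (Fin s) ℤ, A * S = 1
  mem_Zker_iff : ∀ v, v ∈ X.Zker j ↔ A *ᵥ v = 0
  ZkerQ_eq : X.ZkerQ j = LinearMap.ker (A.map (Int.cast : ℤ → ℚ)).mulVecLin
  tau_eq : (X.tau j : ℤ) = (A * Aᵀ).det

theorem IsCyclePresentation.add_finrank_ZkerQ {s : ℕ} {A : Matrix (Fin s) (Fin (X.c j)) ℤ}
    (hA : X.IsCyclePresentation j A) : s + Module.finrank ℚ (X.ZkerQ j) = X.c j := by
  obtain ⟨S, hS⟩ := hA.exists_right_inverse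
  have hS' : A.map (Int.cast : ℤ → ℚ) * S.map (Int.cast : ℤ → ℚ) = 1 :=
    Matrix.map_intCast_mul_eq_one ℚ hS
  have hsurj : LinearMap.range (A.map (Int.cast : ℤ → ℚ)).mulVecLin = ⊤ :=
    LinearMap.range_eq_top.mpr (Matrix.mulVec_surjective_iff_exists_right_inverse.mpr ⟨_, hS'⟩)
  have h := (A.map (Int.cast : ℤ → ℚ)).mulVecLin.finrank_range_add_finrank_ker
  rw [hsurj, finrank_top, ← hA.ZkerQ_eq] at h
  simpa using h

variable (X) in
theorem isCyclePresentation_zero (hneg : Subsingleton (ℤ ⧸ LinearMap.range X.aug)) :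
    X.IsCyclePresentation 0 (Matrix.of fun (_ : Fin 1) (_ : Fin (X.c 0)) => (1 : ℤ)) where
  exists_right_inverse := by
    rw [← Matrix.mulVec_surjective_iff_exists_right_inverse]
    intro v
    have hmem : v 0 ∈ LinearMap.range X.aug :=
      Submodule.Quotient.subsingleton_iff.mp hneg ▸ Submodule.mem_top
    obtain ⟨w, hw⟩ := hmem
    refine ⟨w, funext fun i => ?_⟩
    rw [Subsingleton.elim i 0, ← hw]
    simp [Matrix.mulVec, dotProduct, aug]
  mem_Zker_iff v := by
    have h : v ∈ X.Zker 0 ↔ ∑ i, v i = 0 := Iff.rfl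
    simp [h, funext_iff, Matrix.mulVec, dotProduct]
  ZkerQ_eq := by
    ext v
    have h : v ∈ X.ZkerQ 0 ↔ ∑ i, v i = 0 := Iff.rfl
    simp [h, funext_iff, Matrix.mulVec, dotProduct]
  tau_eq := by
    simp [tau, Matrix.det_unique, Matrix.mul_apply]

theorem IsCyclePresentation.succ {s : ℕ} {A : Matrix (Fin s) (Fin (X.c j)) ℤ}
    (hA : X.IsCyclePresentation j A) (hH : Subsingleton (X.H j)) :
    (∃ (r : ℕ) (A' : Matrix (Fin r) (Fin (X.c (j + 1))) ℤ), X.IsCyclePresentation (j + 1) A') ∧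
      (X.tau (j + 1) : ℝ) * X.tau j = X.piNZ (j + 1) := by
  let b := Module.finBasis ℤ (X.Zker j)
  obtain ⟨S, hS⟩ := hA.exists_right_inverse
  have hAB : A * cycleMatrix b = 0 := by
    rw [Matrix.ext_iff_mulVec]
    intro v
    rw [← Matrix.mulVec_mulVec, Matrix.zero_mulVec, ← hA.mem_Zker_iff, cycleMatrix_mulVec]
    exact Subtype.coe_prop _
  obtain ⟨hcard, ⟨C, hC⟩, hne, hgram⟩ := Matrix.gram_eq_of_exact (cycleMatrix b) A S hS hAB
    (cycleMatrix_mulVec_injective b)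
    fun v hv => exists_cycleMatrix_mulVec_eq b ((hA.mem_Zker_iff v).mpr hv)
  have hrank := hA.add_finrank_ZkerQ
  simp only [Fintype.card_fin] at hcard
  have htau := tau_succ_eq_det b (by omega)
  obtain ⟨S', hS'⟩ := coordMatrix_exists_right_inverse b hH
  have hpres : X.IsCyclePresentation (j + 1) (coordMatrix b) := by
    refine ⟨⟨S', hS'⟩, mem_Zker_succ_iff b, ?_, htau⟩
    ext v
    have hC' : C.map (Int.cast : ℤ → ℚ) * (cycleMatrix b).map (Int.cast : ℤ → ℚ) = 1 :=
      Matrix.map_intCast_mul_eq_one ℚ hC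
    have hD : (X.D j).map (Int.cast : ℤ → ℚ) =
        (cycleMatrix b).map (Int.cast : ℤ → ℚ) * (coordMatrix b).map (Int.cast : ℤ → ℚ) := by
      rw [← Matrix.map_intCast_mul, cycleMatrix_mul_coordMatrix]
    have h : v ∈ X.ZkerQ (j + 1) ↔ (X.D j).map (Int.cast : ℤ → ℚ) *ᵥ v = 0 := Iff.rfl
    rw [h, hD, LinearMap.mem_ker, Matrix.mulVecLin_apply, ← Matrix.mulVec_mulVec]
    refine ⟨fun h0 => ?_, fun h0 => by rw [h0, Matrix.mulVec_zero]⟩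
    have := congrArg (fun w => C.map (Int.cast : ℤ → ℚ) *ᵥ w) h0
    simpa only [Matrix.mulVec_mulVec, ← Matrix.mul_assoc, hC', Matrix.one_mul,
      Matrix.mulVec_zero] using this
  refine ⟨⟨_, _, hpres⟩, ?_⟩
  have hDr : X.Dr j = (cycleMatrix b).map (Int.cast : ℤ → ℝ) *
      (coordMatrix b).map (Int.cast : ℤ → ℝ) := by
    rw [← Matrix.map_intCast_mul, cycleMatrix_mul_coordMatrix, Dr]
  set P := (cycleMatrix b).map (Int.cast : ℤ → ℝ) with hP
  set Q := (coordMatrix b).map (Int.cast : ℤ → ℝ) with hQ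
  have hQdet : (Q * Qᵀ).det = X.tau (j + 1) := by
    have := congrArg (Int.cast : ℤ → ℝ) htau
    rw [Int.cast_natCast] at this
    rw [this, Int.cast_det, hQ, ← Matrix.transpose_map, ← Matrix.map_intCast_mul]
  have hPdet : (Pᵀ * P).det = X.tau j := by
    have := congrArg (Int.cast : ℤ → ℝ) (hA.tau_eq.trans hgram.symm)
    rw [Int.cast_natCast] at this
    rw [this, Int.cast_det, hP, ← Matrix.transpose_map, ← Matrix.map_intCast_mul]
  have hL : X.Lud j = P * (Q * Qᵀ * Pᵀ) := by
    rw [Lud, hDr, Matrix.conjTranspose_eq_transpose_of_trivial, Matrix.transpose_mul]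
    simp only [Matrix.mul_assoc]
  have hdet : (Q * Qᵀ * Pᵀ * P).det = X.tau (j + 1) * X.tau j := by
    rw [Matrix.mul_assoc (Q * Qᵀ), Matrix.det_mul, hQdet, hPdet]
  have htau0 : X.tau j ≠ 0 := by
    rw [hgram, ← hA.tau_eq] at hne
    exact_mod_cast hne
  have htau1 : X.tau (j + 1) ≠ 0 := by
    have hinj : Function.Injective (coordMatrix b)ᵀ.mulVec := by
      refine Function.LeftInverse.injective (g := S'ᵀ.mulVec) fun v => ?_
      rw [Matrix.mulVec_mulVec, ← Matrix.transpose_mul, hS', Matrix.transpose_one,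
        Matrix.one_mulVec]
    have h := Matrix.det_transpose_mul_self_ne_zero _ hinj
    rw [Matrix.transpose_transpose, ← htau] at h
    exact_mod_cast h
  rw [piNZ, Matrix.prod_nonzero_eigenvalues_eq_abs_det P (Q * Qᵀ * Pᵀ) (X.Lud j)
    (X.Lud_isHermitian j) (Matrix.posSemidef_self_mul_conjTranspose _) hL
    (by rw [hdet]; positivity), hdet, abs_of_nonneg (by positivity)]

theorem tau_succ_mul_tau {j : ℕ} (hneg : Subsingleton (ℤ ⧸ LinearMap.range X.aug))
    (hlow : ∀ i ≤ j, Subsingleton (X.H i)) :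
    (X.tau (j + 1) : ℝ) * X.tau j = X.piNZ (j + 1) := by
  have h : ∀ i ≤ j, ∃ (s : ℕ) (A : Matrix (Fin s) (Fin (X.c i)) ℤ),
      X.IsCyclePresentation i A := by
    intro i
    induction i with
    | zero => exact fun _ => ⟨_, _, X.isCyclePresentation_zero hneg⟩
    | succ i ih =>
      intro hi
      obtain ⟨s, A, hA⟩ := ih (by omega)
      exact (hA.succ (hlow i (by omega))).1
  obtain ⟨s, A, hA⟩ := h j le_rfl
  exact (hA.succ (hlow j le_rfl)).2

theorem prod_filter_odd_succ (f : ℕ → ℝ) (k : ℕ) :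
    ∏ i ∈ (Finset.range (k + 2)).filter (fun i => Odd (k + 1 - i)), f i =
      ∏ i ∈ (Finset.range (k + 1)).filter (fun i => Even (k - i)), f i := by
  refine Finset.prod_congr (Finset.ext fun i => ?_) fun _ _ => rfl
  simp only [Finset.mem_filter, Finset.mem_range, Nat.odd_iff, Nat.even_iff]
  omega

theorem prod_filter_even_succ (f : ℕ → ℝ) (k : ℕ) :
    ∏ i ∈ (Finset.range (k + 2)).filter (fun i => Even (k + 1 - i)), f i =
      (∏ i ∈ (Finset.range (k + 1)).filter (fun i => Odd (k - i)), f i) * f (k + 1) := by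
  rw [mul_comm, ← Finset.prod_insert (by simp)]
  refine Finset.prod_congr (Finset.ext fun i => ?_) fun _ _ => rfl
  simp only [Finset.mem_insert, Finset.mem_filter, Finset.mem_range, Nat.odd_iff, Nat.even_iff]
  omega

end CellStructure

open Classical in
/-- **Alternating product formula** (Duval–Klivans–Martin, Cor. 2.11).
Let `d = e + 1 ≥ 1` and let `X` be a `d`-dimensional combinatorial cell structure with
`H_i(X) = 0` (over `ℤ`) for all `-1 ≤ i ≤ d - 1`.  Then for every `1 ≤ k ≤ d`,
`τ_k(X) · ∏_{0 ≤ i ≤ k, k - i odd} π_i(X) = ∏_{0 ≤ i ≤ k, k - i even} π_i(X)`,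
i.e. `τ_k(X) = ∏_{i=0}^k π_i(X)^{(-1)^{k-i}}`. -/
theorem alternating_product_formula
    (e : ℕ) (X : CellStructure (e + 1))
    (hneg : Subsingleton (ℤ ⧸ LinearMap.range X.aug))
    (hlow : ∀ i, i < e + 1 → Subsingleton (X.H i)) :
    ∀ k, 1 ≤ k → k ≤ e + 1 →
      (X.tau k : ℝ) *
          ∏ i ∈ (Finset.range (k + 1)).filter (fun i => Odd (k - i)), X.piNZ i =
        ∏ i ∈ (Finset.range (k + 1)).filter (fun i => Even (k - i)), X.piNZ i := by
  suffices h : ∀ k ≤ e + 1, _ from fun k _ hk => h k hk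
  intro k
  induction k with
  | zero => simp [CellStructure.tau, CellStructure.piNZ]
  | succ k ih =>
    intro hk
    have hstep := CellStructure.tau_succ_mul_tau hneg fun i (hi : i ≤ k) => hlow i (by omega)
    rw [CellStructure.prod_filter_odd_succ, CellStructure.prod_filter_even_succ,
      ← ih (by omega), ← hstep]
    ring
end

section
/- Prism spectrum, up-down Laplacians: Let X ⊆ Q_n be a proper cubical complex and let P X = {f ∈ Q_{n+1} : (f_1, …, f_n) ∈ X} be its prism. Then for every i ≥ 0, the multiset of nonzero eigenvalues of L^ud_i(P X) equals the multiset sum of: the multiset of nonzero eigenvalues of L^ud_i(X), and the multiset {λ + 2 : λ ∈ s^tot_i(X)} (the full spectrum of L^tot_i(X) shifted by 2; every such λ + 2 is nonzero since Laplacians are positive semidefinite). -/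
open BigOperators Matrix

namespace CubicalPaper

/-- Faces of the `n`-cube `Q_n`: tuples in `{0, 1, ✱}ⁿ`, with `2 : Fin 3` playing the
role of `✱`. -/
abbrev Face (n : ℕ) : Type := Fin n → Fin 3

/-- The direction set of a face: the coordinates equal to `✱`. -/
def dir {n : ℕ} (f : Face n) : Finset (Fin n) := Finset.univ.filter fun i => f i = 2

/-- The dimension of a face. -/
def fdim {n : ℕ} (f : Face n) : ℕ := (dir f).card

/-- The partial order on `Q_n`: `f ≤ g` iff `f i = g i` whenever `g i ≠ ✱`. -/
def cubeLE {n : ℕ} (f g : Face n) : Prop := ∀ i, g i ≠ 2 → f i = g i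

/-- A proper cubical complex: a downward-closed set of faces of `Q_n`. -/
def IsComplex {n : ℕ} (X : Finset (Face n)) : Prop :=
  ∀ g ∈ X, ∀ f, cubeLE f g → f ∈ X

/-- The incidence sign `ε(f, g)`: if `dir g = {a_1 < ⋯ < a_i}` and `f` is obtained from
`g` by changing the entry `g (a_j) = ✱` to `0` (resp. `1`), then `ε(f,g) = (-1)^j`
(resp. `(-1)^(j+1)`); in all other cases `ε(f,g) = 0`. -/
def eps {n : ℕ} (f g : Face n) : ℤ :=
  ∑ a : Fin n,
    if g a = 2 ∧ f a ≠ 2 ∧ ∀ b, b ≠ a → f b = g b then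
      (-1 : ℤ) ^ ((Finset.univ.filter fun b => g b = 2 ∧ b ≤ a).card +
        if f a = 1 then 1 else 0)
    else 0

/-- The `k`-dimensional faces of `X`. -/
def faceSet {n : ℕ} (X : Finset (Face n)) (k : ℕ) : Finset (Face n) :=
  X.filter fun f => fdim f = k

/-- The real cubical boundary matrix `∂_{k+1}` of `X`, with rows indexed by `X_k`
and columns by `X_{k+1}`, entries `ε(f, g)`. -/
def bdryM {n : ℕ} (X : Finset (Face n)) (k : ℕ) :
    Matrix {f // f ∈ faceSet X k} {g // g ∈ faceSet X (k + 1)} ℝ :=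
  Matrix.of fun f g => (eps f.1 g.1 : ℝ)

/-- The up-down Laplacian `L^ud_k = ∂_{k+1} ∂_{k+1}^T`. -/
noncomputable def Lud {n : ℕ} (X : Finset (Face n)) (k : ℕ) :
    Matrix {f // f ∈ faceSet X k} {f // f ∈ faceSet X k} ℝ :=
  bdryM X k * (bdryM X k)ᵀ

/-- The down-up Laplacian `L^du_k = ∂_k^T ∂_k` (with `∂_0 = 0`). -/
noncomputable def Ldu {n : ℕ} (X : Finset (Face n)) :
    (k : ℕ) → Matrix {f // f ∈ faceSet X k} {f // f ∈ faceSet X k} ℝ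
  | 0 => 0
  | (j + 1) => (bdryM X j)ᵀ * bdryM X j

/-- The total Laplacian `L^tot_k = L^ud_k + L^du_k`. -/
noncomputable def Ltot {n : ℕ} (X : Finset (Face n)) (k : ℕ) :
    Matrix {f // f ∈ faceSet X k} {f // f ∈ faceSet X k} ℝ :=
  Lud X k + Ldu X k

/-- The spectrum `s^tot_k(X)` of `L^tot_k`: the multiset of roots of its characteristic
polynomial (all of which are real, `L^tot_k` being real symmetric). -/
noncomputable def stot {n : ℕ} (X : Finset (Face n)) (k : ℕ) : Multiset ℝ :=
  (Ltot X k).charpoly.roots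

/-- The spectrum `s^ud_k(X)` of `L^ud_k`. -/
noncomputable def sud {n : ℕ} (X : Finset (Face n)) (k : ℕ) : Multiset ℝ :=
  (Lud X k).charpoly.roots

/-- The prism `P X ⊆ Q_{n+1}` over `X ⊆ Q_n`: all faces whose first `n` coordinates
form a face of `X`. -/
def prism {n : ℕ} (X : Finset (Face n)) : Finset (Face (n + 1)) :=
  Finset.univ.filter fun f => Fin.init f ∈ X

/-- The face of `Q_{n+1}` with first coordinates `f` and last coordinate `c`. -/
abbrev extend {n : ℕ} (f : Face n) (c : Fin 3) : Face (n + 1) :=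
  Fin.snoc (α := fun _ => Fin 3) f c

lemma extend_inj {n : ℕ} {f g : Face n} {c d : Fin 3} :
    extend f c = extend g d ↔ f = g ∧ c = d :=
  Fin.snoc_inj

lemma extend_init_last {n : ℕ} (f : Face (n + 1)) :
    extend (Fin.init f : Face n) (f (Fin.last n)) = f :=
  Fin.snoc_init_self f

lemma fdim_extend {n : ℕ} (f : Face n) (c : Fin 3) :
    fdim (extend f c) = fdim f + if c = 2 then 1 else 0 := by
  simp only [fdim, dir, Finset.card_filter, Fin.sum_univ_castSucc, extend, Fin.snoc_castSucc,
    Fin.snoc_last]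

lemma eps_extend {n : ℕ} (f g : Face n) (c d : Fin 3) :
    eps (extend f c) (extend g d) =
      (if c = d then eps f g else 0) +
        if d = 2 ∧ c ≠ 2 ∧ f = g then
          (-1 : ℤ) ^ (fdim g + 1 + if c = 1 then 1 else 0) else 0 := by
  unfold eps
  rw [Fin.sum_univ_castSucc]
  congr 1
  · simp only [Fin.forall_fin_succ', extend, Fin.snoc_castSucc, Fin.snoc_last, Finset.card_filter,
      Fin.sum_univ_castSucc]
    split_ifs with h
    · refine Finset.sum_congr rfl fun a _ => ?_
      simp [h, Fin.castSucc_inj, Fin.last_le_iff]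
    · refine Finset.sum_eq_zero fun a _ => ?_
      simp [h, (Fin.castSucc_lt_last a).ne']
  · simp only [Fin.forall_fin_succ', extend, Fin.snoc_castSucc, Fin.snoc_last, Finset.card_filter,
      Fin.sum_univ_castSucc, fdim, dir, funext_iff]
    simp only [Fin.le_last, and_true]
    by_cases hd : d = 2 <;> simp [hd]

lemma fdim_eq_of_eps_ne_zero {n : ℕ} {f g : Face n} (h : eps f g ≠ 0) :
    fdim g = fdim f + 1 := by
  induction n with
  | zero => simp [eps] at h
  | succ n ih =>
    rw [← extend_init_last f, ← extend_init_last g] at h ⊢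
    rw [eps_extend] at h
    rw [fdim_extend, fdim_extend]
    generalize f (Fin.last n) = c at *
    generalize g (Fin.last n) = d at *
    by_cases h2 : d = 2 ∧ c ≠ 2 ∧ (Fin.init f : Face n) = Fin.init g
    · simp [h2]
    · rw [if_neg h2, add_zero] at h
      have hcd : c = d := by
        by_contra hne
        simp [hne] at h
      rw [if_pos hcd] at h
      rw [ih h, hcd]
      ring

lemma cubeLE_of_eps_ne_zero {n : ℕ} {f g : Face n} (h : eps f g ≠ 0) : cubeLE f g := by
  obtain ⟨a, -, ha⟩ := Finset.exists_ne_zero_of_sum_ne_zero h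
  have ha := (ite_ne_right_iff.mp ha).1
  intro i hi
  exact ha.2.2 i (by rintro rfl; exact hi ha.1)

lemma sum_eps_mul_eps {n : ℕ} (h g : Face n) : ∑ f : Face n, eps h f * eps f g = 0 := by
  induction n with
  | zero => simp [eps]
  | succ n ih =>
    rw [← extend_init_last h, ← extend_init_last g]
    generalize (Fin.init h : Face n) = h'
    generalize (Fin.init g : Face n) = g'
    generalize h (Fin.last n) = a
    generalize g (Fin.last n) = b
    have key : ∑ f : Face (n + 1), eps (extend h' a) f * eps f (extend g' b) =
        ∑ c : Fin 3, ∑ f : Face n,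
          eps (extend h' a) (extend f c) * eps (extend f c) (extend g' b) := by
      rw [← Fintype.sum_prod_type',
        ← Equiv.sum_comp (Fin.snocEquiv (fun _ : Fin (n + 1) => Fin 3))]
      rfl
    have hdim : eps h' g' = 0 ∨ fdim g' = fdim h' + 1 :=
      or_iff_not_imp_left.mpr fdim_eq_of_eps_ne_zero
    rw [key, Fin.sum_univ_three]
    simp only [eps_extend]
    fin_cases a <;> fin_cases b <;> simp [ih] <;>
      rcases hdim with h0 | h0 <;> simp [h0, pow_succ, mul_comm]

/-- The faces of `X` of dimension `k - 1`; there are none for `k = 0`. -/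
abbrev LowerFace {n : ℕ} (X : Finset (Face n)) (k : ℕ) : Type :=
  {f : Face n // f ∈ X ∧ fdim f + 1 = k}

/-- The boundary matrix from `k`-faces to `(k - 1)`-faces, with no rows for `k = 0`. -/
def lowerBdry {n : ℕ} (X : Finset (Face n)) (k : ℕ) :
    Matrix (LowerFace X k) {f // f ∈ faceSet X k} ℝ :=
  Matrix.of fun f g => (eps f.1 g.1 : ℝ)

/-- The `k`-faces of `X`, viewed as the lower faces for `k + 1`. -/
def lowerFaceEquiv {n : ℕ} (X : Finset (Face n)) (k : ℕ) :
    {f // f ∈ faceSet X k} ≃ LowerFace X (k + 1) :=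
  Equiv.subtypeEquivRight fun f => by simp [faceSet]

lemma Ldu_eq {n : ℕ} (X : Finset (Face n)) (k : ℕ) :
    Ldu X k = (lowerBdry X k)ᵀ * lowerBdry X k := by
  cases k with
  | zero =>
    ext f g
    have : IsEmpty (LowerFace X 0) := ⟨fun f => by simpa using f.2.2⟩
    simp [Ldu, Matrix.mul_apply]
  | succ k =>
    ext f g
    simp only [Ldu, Matrix.mul_apply, Matrix.transpose_apply]
    exact Fintype.sum_equiv (lowerFaceEquiv X k) _ _ fun _ => rfl

lemma lowerBdry_mul_bdryM {n : ℕ} {X : Finset (Face n)} (hX : IsComplex X) (k : ℕ) :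
    lowerBdry X k * bdryM X k = 0 := by
  ext h g
  simp only [Matrix.mul_apply, lowerBdry, bdryM, Matrix.of_apply, Matrix.zero_apply]
  rw [Finset.sum_coe_sort (faceSet X k) fun f => (eps h.1 f : ℝ) * (eps f g.1 : ℝ)]
  have hz := sum_eps_mul_eps h.1 g.1
  rw [← Finset.sum_subset (Finset.subset_univ (faceSet X k))] at hz
  · exact_mod_cast hz
  · intro f _ hf
    by_contra hne
    have hg := g.2
    simp only [faceSet, Finset.mem_filter] at hf hg
    have hfg := right_ne_zero_of_mul hne
    have := fdim_eq_of_eps_ne_zero hfg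
    exact hf ⟨hX g.1 hg.1 f (cubeLE_of_eps_ne_zero hfg), by omega⟩

lemma mem_faceSet_prism {n : ℕ} {X : Finset (Face n)} {k : ℕ} {f : Face n} {c : Fin 3} :
    extend f c ∈ faceSet (prism X) k ↔ f ∈ X ∧ fdim f + (if c = 2 then 1 else 0) = k := by
  simp only [faceSet, prism, Finset.mem_filter, fdim_extend, Finset.mem_univ, true_and]
  simp [extend, Fin.init_snoc]

/-- The inclusion of the bottom, top and vertical `k`-faces into the prism. -/
def prismFace {n : ℕ} (X : Finset (Face n)) (k : ℕ) :
    ({f // f ∈ faceSet X k} ⊕ {f // f ∈ faceSet X k}) ⊕ LowerFace X k →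
      {f // f ∈ faceSet (prism X) k}
  | .inl (.inl f) => ⟨extend f.1 0, mem_faceSet_prism.mpr (by simpa [faceSet] using f.2)⟩
  | .inl (.inr f) => ⟨extend f.1 1, mem_faceSet_prism.mpr (by simpa [faceSet] using f.2)⟩
  | .inr f => ⟨extend f.1 2, mem_faceSet_prism.mpr (by simpa using f.2)⟩

lemma prismFace_bijective {n : ℕ} (X : Finset (Face n)) (k : ℕ) :
    Function.Bijective (prismFace X k) := by
  constructor
  · rintro ((f | f) | f) ((g | g) | g) h <;>
      simpa [prismFace, extend_inj, -Fin.snoc_inj, Subtype.val_inj] using h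
  · rintro ⟨f, hf⟩
    rw [← extend_init_last f, mem_faceSet_prism] at hf
    have hc : ∀ c : Fin 3, c = 0 ∨ c = 1 ∨ c = 2 := by decide
    rcases hc (f (Fin.last n)) with h | h | h
    · refine ⟨.inl (.inl ⟨Fin.init f, by simpa [faceSet, h] using hf⟩), ?_⟩
      simp only [prismFace, ← h, extend_init_last]
    · refine ⟨.inl (.inr ⟨Fin.init f, by simpa [faceSet, h] using hf⟩), ?_⟩
      simp only [prismFace, ← h, extend_init_last]
    · refine ⟨.inr ⟨Fin.init f, by simpa [h] using hf⟩, ?_⟩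
      simp only [prismFace, ← h, extend_init_last]

/-- The `k`-faces of the prism are the bottom, top and vertical ones. -/
noncomputable def prismEquiv {n : ℕ} (X : Finset (Face n)) (k : ℕ) :
    ({f // f ∈ faceSet X k} ⊕ {f // f ∈ faceSet X k}) ⊕ LowerFace X k ≃
      {f // f ∈ faceSet (prism X) k} :=
  Equiv.ofBijective _ (prismFace_bijective X k)

section Block

variable {A B C : Type*}

/-- The block form of the boundary matrix of a prism, for boundary matrices `M` and `N` of the
base and a sign `s`. -/
def prismBlock [DecidableEq A] (M : Matrix A B ℝ) (N : Matrix C A ℝ) (s : ℝ) :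
    Matrix ((A ⊕ A) ⊕ C) ((B ⊕ B) ⊕ A) ℝ :=
  fromBlocks (fromBlocks M 0 0 M) (fromRows (s • 1) (-s • 1)) 0 N

lemma charpoly_prismBlock [Fintype A] [Fintype B] [Fintype C] [DecidableEq A] [DecidableEq C]
    (M : Matrix A B ℝ) (N : Matrix C A ℝ) (s : ℝ) (hs : s * s = 1) (hNM : N * M = 0) :
    (prismBlock M N s * (prismBlock M N s)ᵀ).charpoly =
      (M * Mᵀ).charpoly * (M * Mᵀ + Nᵀ * N + scalar A 2).charpoly *
        Polynomial.X ^ Fintype.card C := by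
  let P : Matrix ((A ⊕ A) ⊕ C) ((A ⊕ A) ⊕ C) ℝ :=
    fromBlocks (fromBlocks 1 1 1 (-1)) 0 (fromCols (-(s / 2) • N) ((s / 2) • N)) 1
  let Q : Matrix ((A ⊕ A) ⊕ C) ((A ⊕ A) ⊕ C) ℝ :=
    fromBlocks ((1 / 2 : ℝ) • fromBlocks 1 1 1 (-1)) 0 (fromCols 0 ((s / 2) • N)) 1
  have hQP : Q * P = 1 := by
    simp [P, Q, fromBlocks_multiply, fromCols_mul_fromBlocks, fromBlocks_smul]
    have hN : fromCols ((s / 2) • N) (-((s / 2) • N)) + fromCols (-((s / 2) • N)) ((s / 2) • N) =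
        0 := by
      ext i (j | j) <;> simp
    rw [← add_smul, hN]
    norm_num
  have hT : P * (prismBlock M N s * (prismBlock M N s)ᵀ) * Q =
      fromBlocks (fromBlocks (M * Mᵀ) 0 0 (M * Mᵀ + Nᵀ * N + scalar A 2))
        (fromRows 0 ((2 * s) • Nᵀ)) 0 0 := by
    have hPD : P * prismBlock M N s =
        fromBlocks (fromBlocks M M M (-M)) (fromRows 0 ((2 * s) • 1)) 0 0 := by
      simp [P, prismBlock, fromBlocks_multiply, fromCols_mul_fromBlocks, fromBlocks_mul_fromRows,
        fromCols_mul_fromRows, hNM]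
      refine ⟨by rw [← add_smul, two_mul], ?_⟩
      ext i j
      simp only [Matrix.add_apply, Matrix.neg_apply, Matrix.smul_apply, Matrix.zero_apply,
        smul_eq_mul]
      linear_combination -(N i j) * hs
    have hDQ : (prismBlock M N s)ᵀ * Q =
        fromBlocks ((1 / 2 : ℝ) • fromBlocks Mᵀ Mᵀ Mᵀ (-Mᵀ))
          0 (fromCols 0 (s • 1 + (s / 2) • (Nᵀ * N))) Nᵀ := by
      simp [Q, prismBlock, fromBlocks_multiply, fromCols_mul_fromBlocks, fromBlocks_transpose,
        transpose_fromRows]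
      ext i (j | j)
      · simp
      · simp only [Matrix.add_apply, Matrix.smul_apply, fromCols_apply_inr, smul_eq_mul]
        ring
    rw [← Matrix.mul_assoc, Matrix.mul_assoc, hPD, hDQ]
    have h2 : scalar A (2 : ℝ) = (2 : ℝ) • 1 := by
      ext i j
      simp [diagonal_apply, Matrix.one_apply]
    simp [fromBlocks_multiply, h2, -scalar_apply]
    ext (i | i) (j | j)
    · simp
      ring
    · simp
    · simp
    · simp
      linear_combination (2 * (1 : Matrix A A ℝ) i j + (Nᵀ * N) i j) * hs
  calc _ = (P * (prismBlock M N s * (prismBlock M N s)ᵀ) * Q).charpoly := by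
        rw [Matrix.mul_assoc, charpoly_mul_comm, Matrix.mul_assoc, hQP, Matrix.mul_one]
    _ = _ := by
        rw [hT, charpoly_fromBlocks_zero₂₁, charpoly_fromBlocks_zero₂₁, charpoly_zero]

end Block

lemma bdryM_prism_submatrix {n : ℕ} (X : Finset (Face n)) (k : ℕ) :
    (bdryM (prism X) k).submatrix (prismEquiv X k)
        (((Equiv.refl _).sumCongr (lowerFaceEquiv X k)).trans (prismEquiv X (k + 1))) =
      prismBlock (bdryM X k) (lowerBdry X k) ((-1) ^ (k + 1)) := by
  ext r c
  have hdim : ∀ f : {f // f ∈ faceSet X k}, fdim f.1 = k := fun f => by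
    have := f.2
    simp only [faceSet, Finset.mem_filter] at this
    exact this.2
  rcases r with (f | f) | f <;> rcases c with (g | g) | g <;>
    simp [bdryM, prismBlock, prismEquiv, prismFace, lowerFaceEquiv, lowerBdry, eps_extend,
      Matrix.one_apply, hdim, pow_succ]
  split_ifs <;> simp

lemma Lud_prism_charpoly {n : ℕ} {X : Finset (Face n)} (hX : IsComplex X) (k : ℕ) :
    (Lud (prism X) k).charpoly =
      (Lud X k).charpoly * (Ltot X k + scalar _ 2).charpoly *
        Polynomial.X ^ Fintype.card (LowerFace X k) := by
  rw [Ltot, Ldu_eq, Lud, Lud, ← charpoly_prismBlock _ _ ((-1) ^ (k + 1)) _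
    (lowerBdry_mul_bdryM hX k), ← bdryM_prism_submatrix, Matrix.transpose_submatrix,
    Matrix.submatrix_mul_equiv]
  · exact (Matrix.charpoly_reindex (prismEquiv X k).symm _).symm
  · rw [← mul_pow]
    simp

lemma Ltot_posSemidef {n : ℕ} (X : Finset (Face n)) (k : ℕ) : (Ltot X k).PosSemidef := by
  rw [Ltot, Ldu_eq]
  exact (Matrix.posSemidef_self_mul_conjTranspose (bdryM X k)).add
    (Matrix.posSemidef_conjTranspose_mul_self (lowerBdry X k))

lemma nonneg_of_mem_stot {n : ℕ} {X : Finset (Face n)} {k : ℕ} {x : ℝ} (hx : x ∈ stot X k) :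
    0 ≤ x := by
  have h := Ltot_posSemidef X k
  rw [stot, h.isHermitian.roots_charpoly_eq_eigenvalues] at hx
  obtain ⟨i, -, rfl⟩ := Multiset.mem_map.mp hx
  exact h.eigenvalues_nonneg i

lemma roots_charpoly_add_scalar {m : Type*} [Fintype m] [DecidableEq m] (M : Matrix m m ℝ)
    (r : ℝ) : (M + scalar m r).charpoly.roots = M.charpoly.roots.map (fun x => x + r) := by
  have h := Matrix.charpoly_sub_scalar M (-r)
  rw [map_neg, sub_neg_eq_add] at h
  have h1 := Polynomial.roots_comp_C_mul_X_add_C M.charpoly 1 (-r) isUnit_one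
  simpa [h, ← sub_eq_add_neg, -scalar_apply] using h1

/-- **Prism spectrum, up-down Laplacians** (Duval–Klivans–Martin, Thm. 3.2,
eqn. (3.3d)).  For a proper cubical complex `X ⊆ Q_n` and every `i ≥ 0`, the multiset of
nonzero eigenvalues of `L^ud_i(P X)` is the multiset sum of the nonzero eigenvalues of
`L^ud_i(X)` and the full spectrum of `L^tot_i(X)` shifted by `2`. -/
theorem prism_ud_spectrum {n : ℕ} (X : Finset (Face n)) (hX : IsComplex X) :
    ∀ i : ℕ,
      (sud (prism X) i).filter (fun lam => lam ≠ 0) =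
        (sud X i).filter (fun lam => lam ≠ 0) +
          (stot X i).map (fun lam => lam + 2) := by
  intro i
  have hne := (Polynomial.Monic.mul (Polynomial.Monic.mul (charpoly_monic (Lud X i))
    (charpoly_monic (Ltot X i + scalar _ 2)))
    (Polynomial.monic_X_pow (R := ℝ) (Fintype.card (LowerFace X i)))).ne_zero
  rw [sud, Lud_prism_charpoly hX, Polynomial.roots_mul hne,
    Polynomial.roots_mul (left_ne_zero_of_mul hne), roots_charpoly_add_scalar,
    Polynomial.roots_X_pow, Multiset.filter_add, Multiset.filter_add]
  have h1 : Multiset.filter (fun lam : ℝ => lam ≠ 0)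
      (Fintype.card (LowerFace X i) • ({0} : Multiset ℝ)) = 0 := by
    simp [Multiset.filter_eq_nil, Multiset.nsmul_singleton, Multiset.mem_replicate]
  rw [h1, add_zero]
  refine congrArg _ (Multiset.filter_eq_self.mpr fun x hx => ?_)
  obtain ⟨y, hy, rfl⟩ := Multiset.mem_map.mp hx
  have := nonneg_of_mem_stot hy
  positivity

end CubicalPaper
end

section
/- Up-down Laplacian spectra of cubes: For all n ≥ 1 and 0 ≤ k ≤ n−1, the multiset of nonzero eigenvalues of the up-down Laplacian L^ud_k(Q_n) = ∂_{k+1}∂_{k+1}^T of the full cube Q_n consists of the value 2j with multiplicity binom(n,j) · binom(j−1,k), for each integer j with k+1 ≤ j ≤ n. Equivalently, the characteristic polynomial of L^ud_k(Q_n) equals y^{c} · ∏_{j=k+1}^n (y − 2j)^{binom(n,j)·binom(j−1,k)}, where c = binom(n,k)·2^{n−k} − Σ_{j=k+1}^n binom(n,j)·binom(j−1,k). -/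
open BigOperators Matrix

namespace CubicalPaper

open scoped Kronecker

/-- The boundary operator of the whole `n`-cube on the span of all faces. -/
def cubeBdry (n : ℕ) : Matrix (Face n) (Face n) ℝ := Matrix.of fun f g => (eps f g : ℝ)

/-- The splitting of a face of `Q_{n+1}` as a face of `Q_1` times a face of `Q_n`. -/
def faceSucc (n : ℕ) : Face (n + 1) ≃ Fin 3 × Face n :=
  (Fin.consEquiv fun _ : Fin (n + 1) => Fin 3).symm

/-- The boundary operator of the interval. -/
def intervalBdry : Matrix (Fin 3) (Fin 3) ℝ := !![0, 0, -1; 0, 0, 1; 0, 0, 0]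

/-- The grading sign of the interval. -/
def intervalSign : Matrix (Fin 3) (Fin 3) ℝ := !![1, 0, 0; 0, 1, 0; 0, 0, -1]

/-- The eigenvectors (as columns) of the total Laplacian of the interval. -/
def intervalBasis : Matrix (Fin 3) (Fin 3) ℝ := !![1, -1, 0; 1, 1, 0; 0, 0, 1]

/-- The inverse of `intervalBasis`. -/
noncomputable def intervalBasisInv : Matrix (Fin 3) (Fin 3) ℝ :=
  !![1 / 2, 1 / 2, 0; -1 / 2, 1 / 2, 0; 0, 0, 1]

/-- The eigenvalue weight of the columns of `intervalBasis`. -/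
def intervalWeight (x : Fin 3) : ℝ := if x = 0 then 0 else 2

/-- The tensor power of a matrix on the faces of the interval. -/
def facePow (p : Matrix (Fin 3) (Fin 3) ℝ) (n : ℕ) : Matrix (Face n) (Face n) ℝ :=
  Matrix.of fun f w => ∏ i, p (f i) (w i)

/-- The eigenvalue of the total Laplacian of the cube attached to a word. -/
def faceWeight {n : ℕ} (w : Face n) : ℝ := ∑ i, intervalWeight (w i)

theorem eps_cons {n : ℕ} (x y : Fin 3) (f g : Face n) :
    eps (Fin.cons x f : Face (n + 1)) (Fin.cons y g : Face (n + 1)) =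
      (if y = 2 ∧ x ≠ 2 ∧ f = g then (-1) ^ (1 + if x = 1 then 1 else 0) else 0) +
        if x = y then (if y = 2 then -1 else 1) * eps f g else 0 := by
  unfold eps
  rw [Fin.sum_univ_succ]
  congr 1
  · have hcard : y = 2 → (Finset.univ.filter fun b : Fin (n + 1) =>
        (Fin.cons y g : Face (n + 1)) b = 2 ∧ b ≤ 0).card = 1 := by
      intro hy
      rw [Finset.card_eq_one]
      refine ⟨0, ?_⟩
      ext b
      simp only [Finset.mem_filter, Finset.mem_univ, true_and, Finset.mem_singleton, Fin.le_zero_iff]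
      constructor
      · exact fun h => h.2
      · rintro rfl
        simpa using hy
    have hfg : (∀ b : Fin (n + 1), b ≠ 0 →
        (Fin.cons x f : Face (n + 1)) b = (Fin.cons y g : Face (n + 1)) b) ↔ f = g := by
      simp [Fin.forall_fin_succ, funext_iff, Fin.succ_ne_zero]
    simp only [hfg, Fin.cons_zero]
    split_ifs with h <;> simp_all
  · have hcond : ∀ a : Fin n, (∀ b : Fin (n + 1), b ≠ a.succ →
        (Fin.cons x f : Face (n + 1)) b = (Fin.cons y g : Face (n + 1)) b) ↔
          x = y ∧ ∀ b, b ≠ a → f b = g b := by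
      intro a
      simp [Fin.forall_fin_succ, (Fin.succ_ne_zero a).symm]
    have hcard : ∀ a : Fin n, (Finset.univ.filter fun b : Fin (n + 1) =>
        (Fin.cons y g : Face (n + 1)) b = 2 ∧ b ≤ a.succ).card =
          (if y = 2 then 1 else 0) + (Finset.univ.filter fun b => g b = 2 ∧ b ≤ a).card := by
      intro a
      simp only [Finset.card_filter, Fin.sum_univ_succ, Fin.cons_zero, Fin.cons_succ,
        Fin.zero_le, and_true, Fin.succ_le_succ_iff]
    simp only [hcond, hcard, Fin.cons_succ]
    by_cases hxy : x = y
    · simp only [hxy, true_and, if_true, Finset.mul_sum]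
      refine Finset.sum_congr rfl fun a _ => ?_
      by_cases hy : y = 2 <;> simp [hy, pow_add]
    · simp [hxy]

theorem cubeBdry_succ (n : ℕ) :
    cubeBdry (n + 1) =
      (intervalBdry ⊗ₖ 1 + intervalSign ⊗ₖ cubeBdry n).submatrix (faceSucc n) (faceSucc n) := by
  ext f g
  induction f using Fin.consCases with | _ x f => ?_
  induction g using Fin.consCases with | _ y g => ?_
  simp only [cubeBdry, Matrix.of_apply, eps_cons, Matrix.submatrix_apply, Matrix.add_apply,
    Matrix.kroneckerMap_apply, faceSucc, Fin.consEquiv, Equiv.coe_fn_symm_mk, Fin.cons_zero,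
    Fin.tail_cons, Matrix.one_apply]
  by_cases hfg : f = g <;> fin_cases x <;> fin_cases y <;>
    simp [intervalBdry, intervalSign, hfg]

theorem facePow_succ (p : Matrix (Fin 3) (Fin 3) ℝ) (n : ℕ) :
    facePow p (n + 1) = (p ⊗ₖ facePow p n).submatrix (faceSucc n) (faceSucc n) := by
  ext f g
  simp [facePow, faceSucc, Fin.consEquiv, Fin.prod_univ_succ, Fin.tail]

theorem diagonal_faceWeight_succ (n : ℕ) :
    Matrix.diagonal (faceWeight (n := n + 1)) =
      (Matrix.diagonal intervalWeight ⊗ₖ 1 +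
        1 ⊗ₖ Matrix.diagonal (faceWeight (n := n))).submatrix (faceSucc n) (faceSucc n) := by
  rw [← Matrix.diagonal_one, ← Matrix.diagonal_one, Matrix.diagonal_kronecker_diagonal,
    Matrix.diagonal_kronecker_diagonal, Matrix.diagonal_add, Matrix.submatrix_diagonal_equiv]
  congr 1
  ext f
  simp [faceWeight, faceSucc, Fin.consEquiv, Fin.sum_univ_succ, Fin.tail]

theorem intervalBdry_mul_self : intervalBdry * intervalBdry = 0 := by
  ext i j
  fin_cases i <;> fin_cases j <;> simp [intervalBdry, Matrix.mul_apply, Fin.sum_univ_succ]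

theorem intervalBdry_mul_sign : intervalBdry * intervalSign = -intervalBdry := by
  ext i j
  fin_cases i <;> fin_cases j <;>
    simp [intervalBdry, intervalSign, Matrix.mul_apply, Fin.sum_univ_succ]

theorem intervalSign_mul_bdry : intervalSign * intervalBdry = intervalBdry := by
  ext i j
  fin_cases i <;> fin_cases j <;>
    simp [intervalBdry, intervalSign, Matrix.mul_apply, Fin.sum_univ_succ]

theorem intervalSign_mul_self : intervalSign * intervalSign = 1 := by
  ext i j
  fin_cases i <;> fin_cases j <;> simp [intervalSign, Matrix.mul_apply, Fin.sum_univ_succ]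

theorem intervalSign_transpose : intervalSignᵀ = intervalSign := by
  ext i j
  fin_cases i <;> fin_cases j <;> simp [intervalSign]

theorem intervalBasisInv_mul : intervalBasisInv * intervalBasis = 1 := by
  ext i j
  fin_cases i <;> fin_cases j <;>
    norm_num [intervalBasis, intervalBasisInv, Matrix.mul_apply, Fin.sum_univ_succ]

theorem interval_laplacian_mul_basis :
    (intervalBdry * intervalBdryᵀ + intervalBdryᵀ * intervalBdry) * intervalBasis =
      intervalBasis * Matrix.diagonal intervalWeight := by
  ext i j
  fin_cases i <;> fin_cases j <;>
    norm_num [intervalBasis, intervalBdry, intervalWeight, Matrix.mul_apply,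
      Matrix.transpose_apply, -Matrix.cons_mul, Fin.sum_univ_succ, Matrix.diagonal]

theorem cubeBdry_mul_self (n : ℕ) : cubeBdry n * cubeBdry n = 0 := by
  induction n with
  | zero => ext f g; simp [cubeBdry, eps, Matrix.mul_apply]
  | succ n ih =>
    rw [cubeBdry_succ, Matrix.submatrix_mul_equiv]
    simp only [add_mul, mul_add, ← Matrix.mul_kronecker_mul, intervalBdry_mul_self,
      intervalBdry_mul_sign, intervalSign_mul_bdry, intervalSign_mul_self, ih, one_mul, mul_one]
    ext f g
    simp

/-- The total Laplacian of the cube in all dimensions simultaneously. -/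
noncomputable def cubeLaplacian (n : ℕ) : Matrix (Face n) (Face n) ℝ :=
  cubeBdry n * (cubeBdry n)ᵀ + (cubeBdry n)ᵀ * cubeBdry n

theorem cubeLaplacian_succ (n : ℕ) :
    cubeLaplacian (n + 1) =
      ((intervalBdry * intervalBdryᵀ + intervalBdryᵀ * intervalBdry) ⊗ₖ 1 +
        1 ⊗ₖ cubeLaplacian n).submatrix (faceSucc n) (faceSucc n) := by
  have h1 : intervalSign * intervalBdryᵀ = -intervalBdryᵀ := by
    rw [← intervalSign_transpose, ← Matrix.transpose_mul, intervalBdry_mul_sign,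
      Matrix.transpose_neg]
  have h2 : intervalBdryᵀ * intervalSign = intervalBdryᵀ := by
    rw [← intervalSign_transpose, ← Matrix.transpose_mul, intervalSign_mul_bdry]
  rw [cubeLaplacian, cubeBdry_succ, Matrix.transpose_submatrix, Matrix.submatrix_mul_equiv,
    Matrix.submatrix_mul_equiv, cubeLaplacian, Matrix.transpose_add,
    ← Matrix.kroneckerMap_transpose, ← Matrix.kroneckerMap_transpose, intervalSign_transpose]
  simp only [add_mul, mul_add, ← Matrix.mul_kronecker_mul, intervalBdry_mul_sign, h1, h2,
    intervalSign_mul_bdry, intervalSign_mul_self, Matrix.transpose_one, one_mul, mul_one,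
    Matrix.add_kronecker, Matrix.kronecker_add]
  ext f g
  simp
  ring

theorem cubeLaplacian_mul_basis (n : ℕ) :
    cubeLaplacian n * facePow intervalBasis n =
      facePow intervalBasis n * Matrix.diagonal faceWeight := by
  induction n with
  | zero =>
    ext f g
    simp [cubeLaplacian, cubeBdry, eps, faceWeight, Matrix.mul_apply, Matrix.diagonal_apply]
  | succ n ih =>
    rw [cubeLaplacian_succ, facePow_succ, diagonal_faceWeight_succ, Matrix.submatrix_mul_equiv,
      Matrix.submatrix_mul_equiv]
    simp only [add_mul, mul_add, ← Matrix.mul_kronecker_mul, ← interval_laplacian_mul_basis,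
      ← ih, one_mul, mul_one]

theorem facePow_basisInv_mul (n : ℕ) :
    facePow intervalBasisInv n * facePow intervalBasis n = 1 := by
  induction n with
  | zero =>
    ext f g
    obtain rfl := Subsingleton.elim f g
    simp [facePow, Matrix.mul_apply]
  | succ n ih =>
    rw [facePow_succ, facePow_succ, Matrix.submatrix_mul_equiv, ← Matrix.mul_kronecker_mul, ih,
      intervalBasisInv_mul, Matrix.one_kronecker_one, Matrix.submatrix_one_equiv]

theorem eps_eq_zero {n : ℕ} {f g : Face n} (h : fdim g ≠ fdim f + 1) : eps f g = 0 := by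
  refine Finset.sum_eq_zero fun a _ => if_neg ?_
  rintro ⟨hg, hf, hfg⟩
  have ha : a ∉ dir f := by simp [dir, hf]
  refine h ?_
  rw [fdim, fdim, ← Finset.card_insert_of_notMem ha]
  congr 1
  ext b
  by_cases hb : b = a
  · simp [dir, hb, hg]
  · simp [dir, hb, hfg b hb]

theorem facePow_eq_zero {p : Matrix (Fin 3) (Fin 3) ℝ} (hp : ∀ x y, p x y ≠ 0 → (x = 2 ↔ y = 2))
    {n : ℕ} {f w : Face n} (h : fdim f ≠ fdim w) : facePow p n f w = 0 := by
  by_contra hne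
  rw [facePow, Matrix.of_apply, ← ne_eq, Finset.prod_ne_zero_iff] at hne
  refine h (congrArg Finset.card (Finset.filter_congr fun i hi => hp _ _ (hne i hi)))

theorem intervalBasis_support (x y : Fin 3) (h : intervalBasis x y ≠ 0) : x = 2 ↔ y = 2 := by
  revert h
  fin_cases x <;> fin_cases y <;> simp [intervalBasis]

theorem intervalBasisInv_support (x y : Fin 3) (h : intervalBasisInv x y ≠ 0) :
    x = 2 ↔ y = 2 := by
  revert h
  fin_cases x <;> fin_cases y <;> simp [intervalBasisInv]

theorem mem_faceSet_univ {n k : ℕ} {f : Face n} :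
    f ∈ faceSet (Finset.univ : Finset (Face n)) k ↔ fdim f = k := by
  simp [faceSet]

/-- The block of a matrix on faces with rows of dimension `k` and columns of dimension `l`. -/
abbrev faceBlock {n : ℕ} (A : Matrix (Face n) (Face n) ℝ) (k l : ℕ) :
    Matrix {f // f ∈ faceSet (Finset.univ : Finset (Face n)) k}
      {f // f ∈ faceSet (Finset.univ : Finset (Face n)) l} ℝ :=
  A.submatrix Subtype.val Subtype.val

theorem faceBlock_mul {n : ℕ} (A B : Matrix (Face n) (Face n) ℝ) (k l m : ℕ)
    (h : ∀ f g w, fdim f = k → fdim w = m → fdim g ≠ l → A f g * B g w = 0) :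
    faceBlock (A * B) k m = faceBlock A k l * faceBlock B l m := by
  ext f w
  simp only [Matrix.submatrix_apply, Matrix.mul_apply]
  rw [← Finset.sum_subtype (p := (· ∈ faceSet Finset.univ l)) (faceSet Finset.univ l)
    (fun _ => Iff.rfl) fun g => A f.1 g * B g w.1]
  refine (Finset.sum_subset (Finset.subset_univ _) fun g _ hg => ?_).symm
  exact h _ _ _ (mem_faceSet_univ.1 f.2) (mem_faceSet_univ.1 w.2) (mt mem_faceSet_univ.2 hg)

theorem bdryM_mul_bdryM (n k : ℕ) :
    bdryM (Finset.univ : Finset (Face n)) k *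
      bdryM (Finset.univ : Finset (Face n)) (k + 1) =
        (0 : Matrix {f // f ∈ faceSet Finset.univ k}
          {f // f ∈ faceSet Finset.univ (k + 1 + 1)} ℝ) := by
  have h : faceBlock (cubeBdry n * cubeBdry n) k (k + 1 + 1) = 0 := by
    rw [cubeBdry_mul_self]
    rfl
  refine (faceBlock_mul (cubeBdry n) (cubeBdry n) k (k + 1) (k + 1 + 1)
    fun f g w hf _ hg => ?_).symm.trans h
  simp [cubeBdry, eps_eq_zero (f := f) (g := g) (by rwa [hf])]

theorem Ltot_univ (n k : ℕ) :
    Ltot (Finset.univ : Finset (Face n)) k = faceBlock (cubeLaplacian n) k k := by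
  have hup : Lud (Finset.univ : Finset (Face n)) k =
      faceBlock (cubeBdry n * (cubeBdry n)ᵀ) k k := by
    refine (faceBlock_mul (cubeBdry n) (cubeBdry n)ᵀ k (k + 1) k fun f g w hf _ hg => ?_).symm
    simp [cubeBdry, eps_eq_zero (f := f) (g := g) (by rwa [hf])]
  have hdown : Ldu (Finset.univ : Finset (Face n)) k =
      faceBlock ((cubeBdry n)ᵀ * cubeBdry n) k k := by
    cases k with
    | zero =>
      ext f g
      have hf := mem_faceSet_univ.1 f.2
      simp only [Ldu, Matrix.zero_apply, Matrix.submatrix_apply, Matrix.mul_apply]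
      refine (Finset.sum_eq_zero fun h _ => ?_).symm
      simp [cubeBdry, eps_eq_zero (f := h) (g := f.1) (by omega)]
    | succ k =>
      refine (faceBlock_mul (cubeBdry n)ᵀ (cubeBdry n) (k + 1) k (k + 1)
        fun f g w hf _ hg => ?_).symm
      simp [cubeBdry, eps_eq_zero (f := g) (g := f) (by omega)]
  rw [Ltot, hup, hdown]
  rfl

theorem Ltot_charpoly_eq_prod (n k : ℕ) :
    (Ltot (Finset.univ : Finset (Face n)) k).charpoly =
      ∏ w ∈ faceSet (Finset.univ : Finset (Face n)) k,
        (Polynomial.X - Polynomial.C (faceWeight w)) := by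
  have hinv : faceBlock (facePow intervalBasisInv n) k k *
      faceBlock (facePow intervalBasis n) k k = 1 := by
    rw [← faceBlock_mul, facePow_basisInv_mul]
    · exact Matrix.submatrix_one _ Subtype.val_injective
    intro f g w hf _ hg
    rw [facePow_eq_zero intervalBasisInv_support (by omega), zero_mul]
  have hdiag : faceBlock (Matrix.diagonal (faceWeight (n := n))) k k =
      Matrix.diagonal fun w => faceWeight w.1 :=
    Matrix.submatrix_diagonal _ _ Subtype.val_injective
  have hconj : Ltot (Finset.univ : Finset (Face n)) k * faceBlock (facePow intervalBasis n) k k =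
      faceBlock (facePow intervalBasis n) k k * Matrix.diagonal fun w => faceWeight w.1 := by
    rw [Ltot_univ, ← hdiag, ← faceBlock_mul, cubeLaplacian_mul_basis, faceBlock_mul]
    · intro f g w hf _ hg
      rw [facePow_eq_zero intervalBasis_support (by omega), zero_mul]
    · intro f g w _ hw hg
      rw [facePow_eq_zero intervalBasis_support (by omega), mul_zero]
  have hL : Ltot (Finset.univ : Finset (Face n)) k =
      faceBlock (facePow intervalBasis n) k k * (Matrix.diagonal (fun w => faceWeight w.1) *
        faceBlock (facePow intervalBasisInv n) k k) := by
    rw [← mul_assoc, ← hconj, mul_assoc, mul_eq_one_comm.1 hinv, mul_one]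
  rw [hL, Matrix.charpoly_mul_comm, mul_assoc, hinv, mul_one, Matrix.charpoly_diagonal]
  exact Finset.prod_coe_sort _ fun w => Polynomial.X - Polynomial.C (faceWeight w)

theorem card_faces_of_support (n j k : ℕ) :
    ((faceSet (Finset.univ : Finset (Face n)) k).filter
      fun w => (Finset.univ.filter fun i => w i ≠ 0).card = j).card =
        n.choose j * j.choose k := by
  have hpair : (((Finset.univ : Finset (Fin n)).powersetCard j).sigma
      fun J => J.powersetCard k).card = n.choose j * j.choose k := by
    rw [Finset.card_sigma, Finset.sum_congr rfl (g := fun _ => j.choose k)]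
    · simp
    · intro J hJ
      rw [Finset.card_powersetCard, (Finset.mem_powersetCard.1 hJ).2]
  rw [← hpair]
  refine Finset.card_bij' (fun w _ => ⟨Finset.univ.filter fun i => w i ≠ 0, dir w⟩)
    (fun q _ i => if i ∈ q.2 then 2 else if i ∈ q.1 then 1 else 0) ?_ ?_ ?_ ?_
  · intro w hw
    simp only [Finset.mem_filter, mem_faceSet_univ] at hw
    simp only [Finset.mem_sigma, Finset.mem_powersetCard, Finset.subset_univ, true_and]
    refine ⟨hw.2, fun i hi => ?_, hw.1⟩
    have hi : w i = 2 := by simpa [dir] using hi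
    simp [hi]
  · rintro ⟨J, S⟩ h
    simp only [Finset.mem_sigma, Finset.mem_powersetCard, Finset.subset_univ, true_and] at h
    obtain ⟨hJ, hSJ, hS⟩ := h
    simp only [Finset.mem_filter, mem_faceSet_univ]
    refine ⟨hS ▸ congrArg Finset.card ?_, hJ ▸ congrArg Finset.card ?_⟩
    · ext i
      by_cases hi : i ∈ S <;> by_cases hi' : i ∈ J <;> simp [dir, hi, hi']
    · ext i
      have := @hSJ i
      by_cases hi : i ∈ S <;> by_cases hi' : i ∈ J <;> simp_all
  · intro w _
    ext i
    have : w i = 0 ∨ w i = 1 ∨ w i = 2 := by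
      generalize w i = x
      fin_cases x <;> simp
    rcases this with h | h | h <;> simp [dir, h]
  · rintro ⟨J, S⟩ h
    simp only [Finset.mem_sigma, Finset.mem_powersetCard, Finset.subset_univ, true_and] at h
    obtain ⟨hJ, hSJ, hS⟩ := h
    simp only [Sigma.mk.injEq, heq_eq_eq]
    constructor
    · ext i
      have := @hSJ i
      by_cases hi : i ∈ S <;> by_cases hi' : i ∈ J <;> simp_all
    · ext i
      by_cases hi : i ∈ S <;> by_cases hi' : i ∈ J <;> simp [dir, hi, hi']

theorem faceWeight_eq {n : ℕ} (w : Face n) :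
    faceWeight w = ((2 * (Finset.univ.filter fun i => w i ≠ 0).card : ℕ) : ℝ) := by
  rw [faceWeight, Finset.card_filter, Finset.mul_sum, Nat.cast_sum]
  refine Finset.sum_congr rfl fun i _ => ?_
  by_cases h : w i = 0 <;> simp [intervalWeight, h]

/-- The characteristic polynomial of the total Laplacian of the cube. -/
theorem Ltot_charpoly (n k : ℕ) :
    (Ltot (Finset.univ : Finset (Face n)) k).charpoly =
      ∏ j ∈ Finset.range (n + 1),
        (Polynomial.X - Polynomial.C ((2 * j : ℕ) : ℝ)) ^ (n.choose j * j.choose k) := by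
  rw [Ltot_charpoly_eq_prod, ← Finset.prod_fiberwise_of_maps_to
    (g := fun w : Face n => (Finset.univ.filter fun i => w i ≠ 0).card)
    (t := Finset.range (n + 1))]
  · refine Finset.prod_congr rfl fun j _ => ?_
    rw [← card_faces_of_support, ← Finset.prod_const]
    refine Finset.prod_congr rfl fun w hw => ?_
    rw [faceWeight_eq, (Finset.mem_filter.1 hw).2]
  · intro w _
    simpa [Nat.lt_succ_iff] using Finset.card_le_univ (Finset.univ.filter fun i => w i ≠ 0)

theorem charpoly_mul_charpoly_of_mul_eq_zero {m : Type*} [Fintype m] [DecidableEq m]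
    {A B : Matrix m m ℝ} (h : A * B = 0) :
    A.charpoly * B.charpoly = Polynomial.X ^ Fintype.card m * (A + B).charpoly := by
  have hAB : (Polynomial.C : ℝ →+* _).mapMatrix A * (Polynomial.C : ℝ →+* _).mapMatrix B = 0 := by
    rw [← map_mul, h, map_zero]
  rw [Matrix.charpoly, Matrix.charpoly, Matrix.charpoly, ← Matrix.det_mul, ← Matrix.det_smul]
  congr 1
  rw [Matrix.charmatrix, Matrix.charmatrix, Matrix.charmatrix, sub_mul, mul_sub, mul_sub, hAB,
    map_add, Matrix.scalar_apply, ← Matrix.smul_one_eq_diagonal]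
  simp only [Matrix.smul_mul, Matrix.mul_smul, Matrix.one_mul, Matrix.mul_one, smul_sub, smul_add]
  abel

theorem Lud_charpoly_succ (n k : ℕ) :
    (Lud (Finset.univ : Finset (Face n)) k).charpoly *
        (Lud (Finset.univ : Finset (Face n)) (k + 1)).charpoly =
      Polynomial.X ^ (faceSet (Finset.univ : Finset (Face n)) k).card *
        (Ltot (Finset.univ : Finset (Face n)) (k + 1)).charpoly := by
  have hcomm : Polynomial.X ^ (faceSet (Finset.univ : Finset (Face n)) (k + 1)).card *
        (Lud (Finset.univ : Finset (Face n)) k).charpoly =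
      Polynomial.X ^ (faceSet (Finset.univ : Finset (Face n)) k).card *
        (Ldu (Finset.univ : Finset (Face n)) (k + 1)).charpoly := by
    have h := Matrix.charpoly_mul_comm' (bdryM (Finset.univ : Finset (Face n)) k)
      (bdryM Finset.univ k)ᵀ
    simp only [Fintype.card_coe] at h
    exact h
  have hprod := charpoly_mul_charpoly_of_mul_eq_zero
    (A := Ldu (Finset.univ : Finset (Face n)) (k + 1)) (B := Lud Finset.univ (k + 1)) (by
      rw [Ldu, Lud, Matrix.mul_assoc, ← Matrix.mul_assoc (bdryM Finset.univ k), bdryM_mul_bdryM,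
        Matrix.zero_mul, Matrix.mul_zero])
  rw [add_comm (Ldu _ _)] at hprod
  simp only [Fintype.card_coe] at hprod
  refine mul_left_cancel₀ (pow_ne_zero
    (faceSet (Finset.univ : Finset (Face n)) (k + 1)).card Polynomial.X_ne_zero) ?_
  rw [← mul_assoc, hcomm, mul_assoc, hprod, Ltot, mul_left_comm]

/-- The nonzero part of the characteristic polynomial of the up-down Laplacian of the cube. -/
noncomputable def udFactor (n k : ℕ) : Polynomial ℝ :=
  ∏ j ∈ Finset.Icc (k + 1) n,
    (Polynomial.X - Polynomial.C ((2 * j : ℕ) : ℝ)) ^ (n.choose j * (j - 1).choose k)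

theorem udFactor_eq (n k : ℕ) :
    udFactor n k = ∏ j ∈ Finset.range n,
      (Polynomial.X - Polynomial.C ((2 * (j + 1) : ℕ) : ℝ)) ^ (n.choose (j + 1) * j.choose k) := by
  have hsub : Finset.Icc (k + 1) n ⊆ Finset.Ico 1 (n + 1) := by
    intro j hj
    simp only [Finset.mem_Icc, Finset.mem_Ico] at hj ⊢
    omega
  rw [udFactor, Finset.prod_subset hsub, Finset.prod_Ico_eq_prod_range, Nat.add_sub_cancel]
  · refine Finset.prod_congr rfl fun j _ => ?_
    rw [add_comm 1 j, Nat.add_sub_cancel]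
  · intro j hj hj'
    simp only [Finset.mem_Icc, Finset.mem_Ico] at hj hj'
    rw [Nat.choose_eq_zero_of_lt (n := j - 1) (by omega), mul_zero, pow_zero]

theorem monic_udFactor (n k : ℕ) : (udFactor n k).Monic :=
  Polynomial.monic_prod_of_monic _ _ fun _ _ => (Polynomial.monic_X_sub_C _).pow _

theorem natDegree_udFactor (n k : ℕ) :
    (udFactor n k).natDegree = ∑ j ∈ Finset.Icc (k + 1) n, n.choose j * (j - 1).choose k := by
  rw [udFactor, Polynomial.natDegree_prod_of_monic _ _
    fun _ _ => (Polynomial.monic_X_sub_C _).pow _]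
  simp only [Polynomial.natDegree_pow, Polynomial.natDegree_X_sub_C, mul_one]

theorem Ltot_charpoly_zero (n : ℕ) :
    (Ltot (Finset.univ : Finset (Face n)) 0).charpoly = Polynomial.X * udFactor n 0 := by
  rw [Ltot_charpoly, Finset.prod_range_succ', udFactor_eq, mul_comm]
  simp

theorem Ltot_charpoly_succ (n k : ℕ) :
    (Ltot (Finset.univ : Finset (Face n)) (k + 1)).charpoly =
      udFactor n k * udFactor n (k + 1) := by
  rw [Ltot_charpoly, Finset.prod_range_succ', udFactor_eq, udFactor_eq, ← Finset.prod_mul_distrib]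
  simp only [← pow_add, ← mul_add, ← Nat.choose_succ_succ', Nat.choose_zero_succ, mul_zero,
    pow_zero, mul_one]

theorem exists_Lud_charpoly_eq (n k : ℕ) :
    ∃ c, (Lud (Finset.univ : Finset (Face n)) k).charpoly = Polynomial.X ^ c * udFactor n k := by
  induction k with
  | zero => exact ⟨1, by rw [pow_one, ← Ltot_charpoly_zero, Ltot, Ldu, add_zero]⟩
  | succ k ih =>
    obtain ⟨c, hc⟩ := ih
    have hle : c ≤ (faceSet (Finset.univ : Finset (Face n)) k).card := by
      have := congrArg Polynomial.natDegree hc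
      rw [Matrix.charpoly_natDegree_eq_dim, Fintype.card_coe,
        (Polynomial.monic_X_pow c).natDegree_mul (monic_udFactor n k),
        Polynomial.natDegree_X_pow] at this
      omega
    refine ⟨(faceSet (Finset.univ : Finset (Face n)) k).card - c, ?_⟩
    have h := Lud_charpoly_succ n k
    rw [hc, Ltot_charpoly_succ, ← Nat.add_sub_cancel' hle, pow_add] at h
    refine mul_left_cancel₀ (mul_ne_zero (pow_ne_zero c Polynomial.X_ne_zero)
      (monic_udFactor n k).ne_zero) (h.trans ?_)
    ring

theorem card_faceSet_univ (n k : ℕ) :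
    (faceSet (Finset.univ : Finset (Face n)) k).card = n.choose k * 2 ^ (n - k) := by
  have h := congrArg Polynomial.natDegree (Ltot_charpoly n k)
  rw [Matrix.charpoly_natDegree_eq_dim, Fintype.card_coe, Polynomial.natDegree_prod_of_monic _ _
    fun _ _ => (Polynomial.monic_X_sub_C _).pow _] at h
  simp only [Polynomial.natDegree_pow, Polynomial.natDegree_X_sub_C, mul_one] at h
  rw [h]
  rcases le_or_gt k n with hkn | hkn
  · obtain ⟨m, rfl⟩ := Nat.exists_eq_add_of_le hkn
    rw [add_assoc, Finset.sum_range_add, Finset.sum_eq_zero, zero_add, Nat.add_sub_cancel_left,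
      ← Nat.sum_range_choose, Finset.mul_sum]
    · refine Finset.sum_congr rfl fun i _ => ?_
      rw [Nat.choose_mul (Nat.le_add_right k i), Nat.add_sub_cancel_left,
        Nat.add_sub_cancel_left]
    · intro j hj
      rw [Nat.choose_eq_zero_of_lt (Finset.mem_range.1 hj), mul_zero]
  · rw [Nat.choose_eq_zero_of_lt hkn, zero_mul]
    refine Finset.sum_eq_zero fun j hj => ?_
    rw [Nat.choose_eq_zero_of_lt (n := j) (by simp at hj; omega), mul_zero]

/-- **Up-down Laplacian spectra of cubes** (Duval–Klivans–Martin, Thm. 3.4,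
eqn. (3.4)).  For `n ≥ 1` and `0 ≤ k ≤ n - 1`, the nonzero eigenvalues of
`L^ud_k(Q_n) = ∂_{k+1}∂_{k+1}^T` are the numbers `2j` with multiplicity
`binom(n,j)·binom(j-1,k)` for `k + 1 ≤ j ≤ n`; equivalently, its characteristic
polynomial is `y^c · ∏_{j=k+1}^n (y - 2j)^{binom(n,j)·binom(j-1,k)}` where
`c = binom(n,k)·2^{n-k} - Σ_{j=k+1}^n binom(n,j)·binom(j-1,k)`. -/
theorem cube_ud_spectrum (n k : ℕ) (hn : 1 ≤ n) (hk : k ≤ n - 1) :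
    (Lud (Finset.univ : Finset (Face n)) k).charpoly =
      Polynomial.X ^
          (n.choose k * 2 ^ (n - k) -
            ∑ j ∈ Finset.Icc (k + 1) n, n.choose j * (j - 1).choose k) *
        ∏ j ∈ Finset.Icc (k + 1) n,
          (Polynomial.X - Polynomial.C ((2 * j : ℕ) : ℝ)) ^
            (n.choose j * (j - 1).choose k) := by
  obtain ⟨c, hc⟩ := exists_Lud_charpoly_eq n k
  have hdeg := congrArg Polynomial.natDegree hc
  rw [Matrix.charpoly_natDegree_eq_dim, Fintype.card_coe,
    (Polynomial.monic_X_pow c).natDegree_mul (monic_udFactor n k), Polynomial.natDegree_X_pow,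
    natDegree_udFactor, card_faceSet_univ] at hdeg
  rw [hdeg, Nat.add_sub_cancel, hc, udFactor]

end CubicalPaper
end
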